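/- Let ζ₊, ζ₋ be probability measures on [0,∞) with ∫₀^∞ e^x ζ±(dx) < ∞, normalized so that ∫₀^∞ x² ζ₊(dx) + ∫₀^∞ x² ζ₋(dx) = 1, let p = ∫₀^∞ x² ζ₊(dx), let γ₊, γ₋ > 0, and set c = √(p γ₊² + (1−p) γ₋²) and ρ = (p γ₊ − (1−p) γ₋)/c. Then for every u ∈ (0,1) and w < 0 the partial derivatives of the rescaled functions converge: lim_{ε → 0⁺} (1/ε) ∂R^ε/∂u (u,w) = u − ½ + c ρ w and lim_{ε → 0⁺} (1/ε) ∂R^ε/∂w (u,w) = c ρ u + c² w. -/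

import Mathlib

open MeasureTheory Set Filter

/-- `ψ(u) = ∫₀^∞ (e^{ux} − 1) ζ(dx)`. -/
noncomputable def psiM (ζ : MeasureTheory.Measure ℝ) (u : ℝ) : ℝ :=
  ∫ x, (Real.exp (u * x) - 1) ∂ζ

/-- The rescaled function
`R^ε(u,w) = ψ₊(√ε(u + wγ₊)) + ψ₋(√ε(−u + wγ₋)) − u(ψ₊(√ε) + ψ₋(−√ε)) − w√ε(γ₊m₊ + γ₋m₋)`. -/
noncomputable def Reps (ζp ζm : MeasureTheory.Measure ℝ) (γp γm ε u w : ℝ) : ℝ :=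
  psiM ζp (Real.sqrt ε * (u + w * γp)) + psiM ζm (Real.sqrt ε * (-u + w * γm))
    - u * (psiM ζp (Real.sqrt ε) + psiM ζm (-Real.sqrt ε))
    - w * Real.sqrt ε * (γp * (∫ x, x ∂ζp) + γm * (∫ x, x ∂ζm))

open ProbabilityTheory Topology

/-- `ψ'(u) = ∫₀^∞ x e^{ux} ζ(dx)`. -/
noncomputable def psiDeriv (ζ : Measure ℝ) (u : ℝ) : ℝ :=
  ∫ x, x * Real.exp (u * x) ∂ζ

lemma psiDeriv_zero (ζ : Measure ℝ) : psiDeriv ζ 0 = ∫ x, x ∂ζ := by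
  simp [psiDeriv]

lemma psiM_zero (ζ : Measure ℝ) : psiM ζ 0 = 0 := by
  simp [psiM]

section ExponentialMoment

variable {ζ : Measure ℝ}

lemma Iic_one_subset_integrableExpSet (hs : ζ (Iio 0) = 0)
    (hi : Integrable (fun x => Real.exp x) ζ) : Iic 1 ⊆ integrableExpSet id ζ := by
  intro t ht
  have hnonneg : ∀ᵐ x ∂ζ, 0 ≤ x := by
    simpa only [ae_iff, not_le] using! hs
  refine hi.mono' (by fun_prop) ?_
  filter_upwards [hnonneg] with x hx
  rw [Real.norm_eq_abs, Real.abs_exp, Real.exp_le_exp]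
  simpa using mul_le_mul_of_nonneg_right (mem_Iic.mp ht) hx

lemma mem_interior_integrableExpSet_of_lt_one (hs : ζ (Iio 0) = 0)
    (hi : Integrable (fun x => Real.exp x) ζ) {t : ℝ} (ht : t < 1) :
    t ∈ interior (integrableExpSet id ζ) :=
  interior_mono (Iic_one_subset_integrableExpSet hs hi) (by simpa using ht)

lemma hasDerivAt_psiDeriv_zero (hs : ζ (Iio 0) = 0)
    (hi : Integrable (fun x => Real.exp x) ζ) :
    HasDerivAt (psiDeriv ζ) (∫ x, x ^ 2 ∂ζ) 0 := by
  have h := hasDerivAt_integral_pow_mul_exp_real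
    (mem_interior_integrableExpSet_of_lt_one hs hi zero_lt_one) 1
  simp only [id, pow_one, one_add_one_eq_two, zero_mul, Real.exp_zero, mul_one] at h
  exact h

/-- The rescaled first-order expansion of `ψ'` at `0`. -/
lemma tendsto_psiDeriv_sub_div (hs : ζ (Iio 0) = 0)
    (hi : Integrable (fun x => Real.exp x) ζ) (a : ℝ) :
    Tendsto (fun s => (psiDeriv ζ (s * a) - ∫ x, x ∂ζ) / s) (𝓝[≠] 0)
      (𝓝 (a * ∫ x, x ^ 2 ∂ζ)) := by
  have h0 : HasDerivAt (psiDeriv ζ) (∫ x, x ^ 2 ∂ζ) (0 * a) := by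
    simpa using hasDerivAt_psiDeriv_zero hs hi
  have h := (h0.comp (0 : ℝ) ((hasDerivAt_id (0 : ℝ)).mul_const a)).tendsto_slope_zero
  rw [one_mul, mul_comm] at h
  refine h.congr fun s => ?_
  simp [psiDeriv_zero, div_eq_inv_mul]

variable [IsProbabilityMeasure ζ]

lemma hasDerivAt_psiM (hs : ζ (Iio 0) = 0) (hi : Integrable (fun x => Real.exp x) ζ)
    {t : ℝ} (ht : t < 1) : HasDerivAt (psiM ζ) (psiDeriv ζ t) t := by
  have h := (hasDerivAt_mgf (mem_interior_integrableExpSet_of_lt_one hs hi ht)).sub_const 1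
  refine h.congr_of_eventuallyEq ?_
  filter_upwards [Iio_mem_nhds ht] with r hr
  have hr' : Integrable (fun x => Real.exp (r * x)) ζ :=
    Iic_one_subset_integrableExpSet hs hi (mem_Iic.mpr (le_of_lt hr))
  simp [psiM, mgf, integral_sub hr' (integrable_const 1)]

lemma eventually_mul_lt_one (a : ℝ) : ∀ᶠ s : ℝ in 𝓝[≠] 0, s * a < 1 := by
  have h : Tendsto (fun s : ℝ => s * a) (𝓝 0) (𝓝 (0 * a)) := tendsto_id.mul_const a
  exact (h.mono_left nhdsWithin_le_nhds).eventually_lt_const (by simp)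

/-- The rescaled second-order expansion of `ψ` at `0`. -/
lemma tendsto_psiM_sub_div_sq (hs : ζ (Iio 0) = 0)
    (hi : Integrable (fun x => Real.exp x) ζ) (a : ℝ) :
    Tendsto (fun s => (psiM ζ (s * a) - s * a * ∫ x, x ∂ζ) / s ^ 2) (𝓝[≠] 0)
      (𝓝 (a ^ 2 / 2 * ∫ x, x ^ 2 ∂ζ)) := by
  have hderiv {s : ℝ} (h : s * a < 1) :
      HasDerivAt (fun s => psiM ζ (s * a) - s * a * ∫ x, x ∂ζ)
        (psiDeriv ζ (s * a) * a - a * ∫ x, x ∂ζ) s := by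
    have hm : HasDerivAt (fun s => s * a) a s := by
      simpa using (hasDerivAt_id s).mul_const a
    exact ((hasDerivAt_psiM hs hi h).comp s hm).sub (hm.mul_const _)
  refine HasDerivAt.lhopital_zero_nhdsNE
    (f' := fun s => psiDeriv ζ (s * a) * a - a * ∫ x, x ∂ζ) (g' := fun s => 2 * s)
    ?_ ?_ ?_ ?_ ?_ ?_
  · filter_upwards [eventually_mul_lt_one a] with s h using hderiv h
  · exact .of_forall fun s => by simpa using hasDerivAt_pow 2 s
  · filter_upwards [self_mem_nhdsWithin] with s h
    exact mul_ne_zero two_ne_zero h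
  · have h := (hderiv (s := 0) (by simp)).continuousAt.tendsto
    simp only [zero_mul, psiM_zero, sub_zero] at h
    exact h.mono_left nhdsWithin_le_nhds
  · have h : Tendsto (fun s : ℝ => s ^ 2) (𝓝 0) (𝓝 (0 ^ 2)) := tendsto_id.pow 2
    simpa using h.mono_left nhdsWithin_le_nhds
  · have h := (tendsto_psiDeriv_sub_div hs hi a).const_mul (a / 2)
    rw [← mul_assoc, show a / 2 * a = a ^ 2 / 2 by ring] at h
    refine h.congr' ?_
    filter_upwards [self_mem_nhdsWithin] with s hs0
    have : s ≠ 0 := hs0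
    field_simp

end ExponentialMoment

section RescaledDerivatives

variable {ζp ζm : Measure ℝ} [IsProbabilityMeasure ζp] [IsProbabilityMeasure ζm]
  {γp γm ε u w : ℝ}

lemma hasDerivAt_Reps_fst (hsp : ζp (Iio 0) = 0) (hsm : ζm (Iio 0) = 0)
    (hip : Integrable (fun x => Real.exp x) ζp) (him : Integrable (fun x => Real.exp x) ζm)
    (hp : Real.sqrt ε * (u + w * γp) < 1) (hm : Real.sqrt ε * (-u + w * γm) < 1) :
    HasDerivAt (fun u' => Reps ζp ζm γp γm ε u' w)
      (Real.sqrt ε * (psiDeriv ζp (Real.sqrt ε * (u + w * γp))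
          - psiDeriv ζm (Real.sqrt ε * (-u + w * γm)))
        - (psiM ζp (Real.sqrt ε) + psiM ζm (-Real.sqrt ε))) u := by
  have h1 := (hasDerivAt_psiM hsp hip hp).comp u
    (((hasDerivAt_id u).add_const (w * γp)).const_mul (Real.sqrt ε))
  have h2 := (hasDerivAt_psiM hsm him hm).comp u
    (((hasDerivAt_id u).neg.add_const (w * γm)).const_mul (Real.sqrt ε))
  have h3 := (hasDerivAt_id u).mul_const (psiM ζp (Real.sqrt ε) + psiM ζm (-Real.sqrt ε))
  refine (((h1.add h2).sub h3).sub_const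
    (w * Real.sqrt ε * (γp * (∫ x, x ∂ζp) + γm * (∫ x, x ∂ζm)))).congr_deriv ?_
  ring

lemma hasDerivAt_Reps_snd (hsp : ζp (Iio 0) = 0) (hsm : ζm (Iio 0) = 0)
    (hip : Integrable (fun x => Real.exp x) ζp) (him : Integrable (fun x => Real.exp x) ζm)
    (hp : Real.sqrt ε * (u + w * γp) < 1) (hm : Real.sqrt ε * (-u + w * γm) < 1) :
    HasDerivAt (fun w' => Reps ζp ζm γp γm ε u w')
      (Real.sqrt ε * (γp * (psiDeriv ζp (Real.sqrt ε * (u + w * γp)) - ∫ x, x ∂ζp)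
        + γm * (psiDeriv ζm (Real.sqrt ε * (-u + w * γm)) - ∫ x, x ∂ζm))) w := by
  have h1 := (hasDerivAt_psiM hsp hip hp).comp w
    ((((hasDerivAt_id w).mul_const γp).const_add u).const_mul (Real.sqrt ε))
  have h2 := (hasDerivAt_psiM hsm him hm).comp w
    ((((hasDerivAt_id w).mul_const γm).const_add (-u)).const_mul (Real.sqrt ε))
  have h3 := ((hasDerivAt_id w).mul_const (Real.sqrt ε)).mul_const
    (γp * (∫ x, x ∂ζp) + γm * (∫ x, x ∂ζm))
  refine (((h1.add h2).sub_const
    (u * (psiM ζp (Real.sqrt ε) + psiM ζm (-Real.sqrt ε)))).sub h3).congr_deriv ?_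
  ring

end RescaledDerivatives

lemma tendsto_sqrt_nhdsGT_zero : Tendsto Real.sqrt (𝓝[>] 0) (𝓝[≠] 0) := by
  refine tendsto_nhdsWithin_iff.mpr ⟨?_, ?_⟩
  · simpa using (Real.continuous_sqrt.tendsto 0).mono_left nhdsWithin_le_nhds
  · filter_upwards [self_mem_nhdsWithin] with ε hε
    exact (Real.sqrt_pos.mpr hε).ne'

/-- Convergence of the partial derivatives of the rescaled functions: with
`p = ∫ x² ζ₊(dx)`, `c = √(pγ₊² + (1−p)γ₋²)`, `ρ = (pγ₊ − (1−p)γ₋)/c`,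
`(1/ε) ∂R^ε/∂u (u,w) → u − ½ + cρw` and `(1/ε) ∂R^ε/∂w (u,w) → cρu + c²w`
as `ε → 0⁺`, for `u ∈ (0,1)` and `w < 0`. -/
theorem Reps_deriv_tendsto
    (ζp ζm : MeasureTheory.Measure ℝ)
    [IsProbabilityMeasure ζp] [IsProbabilityMeasure ζm]
    (hsp : ζp (Set.Iio 0) = 0) (hsm : ζm (Set.Iio 0) = 0)
    (hip : Integrable (fun x => Real.exp x) ζp)
    (him : Integrable (fun x => Real.exp x) ζm)
    (hnorm : (∫ x, x ^ 2 ∂ζp) + ∫ x, x ^ 2 ∂ζm = 1)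
    (γp γm : ℝ) (hγp : 0 < γp) (hγm : 0 < γm)
    (u w : ℝ) (hu : u ∈ Set.Ioo (0 : ℝ) 1) (hw : w < 0) :
    let p : ℝ := ∫ x, x ^ 2 ∂ζp
    let c : ℝ := Real.sqrt (p * γp ^ 2 + (1 - p) * γm ^ 2)
    let ρ : ℝ := (p * γp - (1 - p) * γm) / c
    Tendsto (fun ε => (1 / ε) * deriv (fun u' => Reps ζp ζm γp γm ε u' w) u)
      (nhdsWithin 0 (Set.Ioi 0)) (nhds (u - 1 / 2 + c * ρ * w)) ∧
    Tendsto (fun ε => (1 / ε) * deriv (fun w' => Reps ζp ζm γp γm ε u w') w)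
      (nhdsWithin 0 (Set.Ioi 0)) (nhds (c * ρ * u + c ^ 2 * w)) := by
  intro p c ρ
  have hq : ∫ x, x ^ 2 ∂ζm = 1 - p := by simp only [p]; linarith
  have hp0 : 0 ≤ p := integral_nonneg fun x => sq_nonneg x
  have hq0 : 0 ≤ 1 - p := hq ▸ integral_nonneg fun x => sq_nonneg x
  have hpos : 0 < p * γp ^ 2 + (1 - p) * γm ^ 2 := by
    rcases hp0.eq_or_lt with h | h
    · rw [← h]
      simp only [zero_mul, zero_add, sub_zero, one_mul]
      positivity
    · positivity
  have hc2 : c ^ 2 = p * γp ^ 2 + (1 - p) * γm ^ 2 := Real.sq_sqrt hpos.le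
  have hcρ : c * ρ = p * γp - (1 - p) * γm := mul_div_cancel₀ _ (Real.sqrt_pos.mpr hpos).ne'
  rw [hc2, hcρ]
  have hsmall : ∀ᶠ ε in 𝓝[>] 0, 0 < ε ∧ Real.sqrt ε * (u + w * γp) < 1 ∧
      Real.sqrt ε * (-u + w * γm) < 1 :=
    (eventually_mem_nhdsWithin).and
      ((tendsto_sqrt_nhdsGT_zero.eventually (eventually_mul_lt_one _)).and
        (tendsto_sqrt_nhdsGT_zero.eventually (eventually_mul_lt_one _)))
  have hdp := tendsto_psiDeriv_sub_div hsp hip (u + w * γp)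
  have hdm := tendsto_psiDeriv_sub_div hsm him (-u + w * γm)
  have hψp := tendsto_psiM_sub_div_sq hsp hip 1
  have hψm := tendsto_psiM_sub_div_sq hsm him (-1)
  constructor
  · have h := ((hdp.sub hdm).sub (hψp.add hψm)).comp tendsto_sqrt_nhdsGT_zero
    rw [hq] at h
    convert! h.congr' ?_ using 2
    · simp only [p]; ring
    · filter_upwards [hsmall] with ε ⟨hε, h1, h2⟩
      rw [(hasDerivAt_Reps_fst hsp hsm hip him h1 h2).deriv]
      have hs : Real.sqrt ε ≠ 0 := (Real.sqrt_pos.mpr hε).ne'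
      have hsq : 1 / ε = 1 / Real.sqrt ε ^ 2 := by rw [Real.sq_sqrt hε.le]
      rw [hsq]
      simp only [Function.comp_apply, mul_one, mul_neg]
      field_simp
      ring
  · have h := ((hdp.const_mul γp).add (hdm.const_mul γm)).comp tendsto_sqrt_nhdsGT_zero
    rw [hq] at h
    convert! h.congr' ?_ using 2
    · simp only [p]; ring
    · filter_upwards [hsmall] with ε ⟨hε, h1, h2⟩
      rw [(hasDerivAt_Reps_snd hsp hsm hip him h1 h2).deriv]
      have hs : Real.sqrt ε ≠ 0 := (Real.sqrt_pos.mpr hε).ne'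
      have hsq : 1 / ε = 1 / Real.sqrt ε ^ 2 := by rw [Real.sq_sqrt hε.le]
      rw [hsq]
      simp only [Function.comp_apply]
      field_simp
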